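/- Suppose Y = F (so n = t(l+1)), H(S̄) = F_{q^t}, and 2m > t (so Orb(S) is an r-FWS code with r = 2m + t(l−1)). Then ω_{2i}(Orb(S)) = (q+1)·q^{2i−1} for every i ∈ {1,…,t−m−1}, and ω_{2(t−m)}(Orb(S)) = (q^n − q^{2(t−m)−1})/(q − 1). -/

import Mathlib

open Module

section Defs

variable {F : Type*} [Field F]

/-- The subspace `α·S = {α * s : s ∈ S}` of `F`, for `S` a subspace over the subfield `Fq`. -/
noncomputable def smulSub (Fq : Subfield F) (α : F) (S : Submodule Fq F) : Submodule Fq F :=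
  S.map (LinearMap.mulLeft Fq α)

/-- The one-orbit cyclic subspace code `Orb(S) = {αS : α ∈ Fˣ}`. -/
def Orb (Fq : Subfield F) (S : Submodule Fq F) : Set (Submodule Fq F) :=
  {T | ∃ α : F, α ≠ 0 ∧ T = smulSub Fq α S}

/-- The number of subspaces `αS` (for `α ∈ Fˣ`) with `dim_{Fq}(S ∩ αS) = d`.
For `dim_{Fq} S = k` and `d = k - i` this is the weight-distribution entry `ω_{2i}(Orb S)`. -/
noncomputable def wt (Fq : Subfield F) (S : Submodule Fq F) (d : ℕ) : ℕ :=
  Set.ncard {T | T ∈ Orb Fq S ∧ finrank Fq ↥(S ⊓ T) = d}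

/-- The stabilizer `H(V) = {x ∈ Fˣ : xV = V} ∪ {0}` of a set `V ⊆ F`. -/
def HStabSet (V : Set F) : Set F :=
  {x : F | x ≠ 0 ∧ (fun y => x * y) '' V = V} ∪ {0}

/-- An `Fqt`-subspace of `F` viewed as an `Fq`-subspace, for `Fq ≤ Fqt`. -/
def toFqSub (Fq Fqt : Subfield F) (h : Fq ≤ Fqt) (W : Submodule Fqt F) : Submodule Fq F where
  carrier := W
  add_mem' := fun ha hb => W.add_mem ha hb
  zero_mem' := W.zero_mem
  smul_mem' := fun c _ hx => W.smul_mem (⟨c.1, h c.2⟩ : Fqt) hx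

/-- The subfield `Fqt` viewed as an `Fq`-subspace of `F`, for `Fq ≤ Fqt`. -/
def subfieldModule (Fq Fqt : Subfield F) (h : Fq ≤ Fqt) : Submodule Fq F where
  carrier := Fqt
  add_mem' := fun ha hb => Fqt.add_mem ha hb
  zero_mem' := Fqt.zero_mem
  smul_mem' := fun c _ hx => Fqt.mul_mem (h c.2) hx

/-- `Orb(S)` is an `r`-FWS code, where `k = dim_{Fq} S`: the weight-distribution entries
`ω_{2i}` are positive for `i ∈ {1, …, k - r}` and zero for `i ∈ {k - r + 1, …, k}`. -/
def IsRFWS (Fq : Subfield F) (S : Submodule Fq F) (k r : ℕ) : Prop :=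
  (∀ i, 1 ≤ i → i ≤ k - r → 0 < wt Fq S (k - i)) ∧
  (∀ i, k - r + 1 ≤ i → i ≤ k → wt Fq S (k - i) = 0)

end Defs

section Poly

open Polynomial

variable {F : Type*} [Field F] (Fq : Subfield F)

theorem mem_smulSub {α x : F} {S : Submodule Fq F} :
    x ∈ smulSub Fq α S ↔ ∃ y ∈ S, α * y = x := by
  simp [smulSub, Submodule.mem_map]

theorem finrank_map_of_injOn {k V W : Type*} [Field k] [AddCommGroup V] [Module k V]
    [AddCommGroup W] [Module k W] (f : V →ₗ[k] W) (p : Submodule k V)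
    (hf : ∀ x ∈ p, f x = 0 → x = 0) : finrank k (p.map f) = finrank k p := by
  have hinj : Function.Injective (f.domRestrict p) := by
    rw [← LinearMap.ker_eq_bot, LinearMap.ker_eq_bot']
    rintro ⟨x, hx⟩ h
    exact Subtype.ext (hf x hx h)
  rw [← LinearMap.finrank_range_of_inj hinj, LinearMap.range_domRestrict]

theorem finrank_smulSub {α : F} (hα : α ≠ 0) (S : Submodule Fq F) :
    finrank Fq (smulSub Fq α S) = finrank Fq S :=
  finrank_map_of_injOn _ _ fun x _ hx => by simpa [hα] using hx

/-- The span of the first `j` powers of `lam`. -/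
def powSpan (lam : F) (j : ℕ) : Submodule Fq F :=
  Submodule.span Fq {x : F | ∃ i < j, x = lam ^ i}

variable {Fq}

theorem powSpan_eq_map (lam : F) (j : ℕ) :
    powSpan Fq lam j = (degreeLT Fq j).map (aeval lam).toLinearMap := by
  classical
  rw [degreeLT_eq_span_X_pow, Submodule.map_span, powSpan]
  congr 1
  ext x
  simp [eq_comm]

theorem mem_powSpan {lam x : F} {j : ℕ} :
    x ∈ powSpan Fq lam j ↔ ∃ f : Fq[X], f.degree < j ∧ aeval lam f = x := by
  simp [powSpan_eq_map, Submodule.mem_map, mem_degreeLT]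

theorem eq_zero_of_aeval_eq_zero {lam : F} {f : Fq[X]}
    (hf : f.degree < (minpoly Fq lam).natDegree) (h : aeval lam f = 0) : f = 0 := by
  by_contra hne
  have h0 := minpoly.degree_le_of_ne_zero Fq lam hne h
  have := h0.trans_lt hf
  rw [degree_eq_natDegree] at this
  · exact lt_irrefl _ this
  · rintro h1
    rw [h1, natDegree_zero] at hf
    exact hne (by simpa using hf)

theorem finrank_degreeLT (j : ℕ) : finrank Fq (degreeLT Fq j) = j := by
  rw [(degreeLTEquiv Fq j).finrank_eq, finrank_fin_fun]

theorem finrank_powSpan {lam : F} {j : ℕ} (hj : j ≤ (minpoly Fq lam).natDegree) :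
    finrank Fq (powSpan Fq lam j) = j := by
  rw [powSpan_eq_map, finrank_map_of_injOn, finrank_degreeLT]
  intro f hf h
  exact eq_zero_of_aeval_eq_zero ((mem_degreeLT.1 hf).trans_le (by exact_mod_cast hj)) h

theorem mul_mem_powSpan {lam x y : F} {i j s : ℕ} (hx : x ∈ powSpan Fq lam i)
    (hy : y ∈ powSpan Fq lam j) (hs : i + j ≤ s + 1) : x * y ∈ powSpan Fq lam s := by
  obtain ⟨f, hf, rfl⟩ := mem_powSpan.1 hx
  obtain ⟨g, hg, rfl⟩ := mem_powSpan.1 hy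
  refine mem_powSpan.2 ⟨f * g, ?_, map_mul _ _ _⟩
  by_cases hf0 : f = 0
  · simp [hf0, bot_lt_iff_ne_bot]
  by_cases hg0 : g = 0
  · simp [hg0, bot_lt_iff_ne_bot]
  rw [degree_eq_natDegree hf0, Nat.cast_lt] at hf
  rw [degree_eq_natDegree hg0, Nat.cast_lt] at hg
  rw [degree_mul, degree_eq_natDegree hf0, degree_eq_natDegree hg0, ← Nat.cast_add, Nat.cast_lt]
  omega

instance finiteDimensional_powSpan (lam : F) (j : ℕ) :
    FiniteDimensional Fq (powSpan Fq lam j) := by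
  rw [powSpan_eq_map]
  have : FiniteDimensional Fq (degreeLT Fq j) := .of_surjective
    (degreeLTEquiv Fq j).symm.toLinearMap (degreeLTEquiv Fq j).symm.surjective
  infer_instance

instance finiteDimensional_smulSub (α : F) (S : Submodule Fq F) [FiniteDimensional Fq S] :
    FiniteDimensional Fq (smulSub Fq α S) :=
  inferInstanceAs (FiniteDimensional Fq (S.map (LinearMap.mulLeft Fq α)))

theorem degree_mul_lt {k : Type*} [Field k] {u g : k[X]} {j a s : ℕ} (hu : u.degree < j)
    (hg : g.natDegree ≤ a) (hs : j + a ≤ s) : (u * g).degree < s := by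
  by_cases hu0 : u = 0
  · simp [hu0, bot_lt_iff_ne_bot]
  by_cases hg0 : g = 0
  · simp [hg0, bot_lt_iff_ne_bot]
  rw [degree_eq_natDegree hu0, Nat.cast_lt] at hu
  rw [degree_mul, degree_eq_natDegree hu0, degree_eq_natDegree hg0, ← Nat.cast_add, Nat.cast_lt]
  omega

/-- If `α` is a reduced fraction `f(lam)/g(lam)` of degree `a`, small with respect to the degree
of `lam`, then the dimension of `P ∩ αP`, `P` the span of `1, …, lam^(j-1)`, is `j - a`. -/
theorem finrank_powSpan_inf_of_coprime {lam α : F} (hα : α ≠ 0) {f g : Fq[X]}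
    (hfg : IsCoprime f g) {a j : ℕ} (hf : f.natDegree ≤ a) (hg : g.natDegree ≤ a)
    (ha : f.natDegree = a ∨ g.natDegree = a) (hj : j + a ≤ (minpoly Fq lam).natDegree)
    (hat : a < (minpoly Fq lam).natDegree)
    (h : α * aeval lam g = aeval lam f) :
    finrank Fq ↥(powSpan Fq lam j ⊓ smulSub Fq α (powSpan Fq lam j)) = j - a := by
  have hlt : ∀ p : Fq[X], p.natDegree ≤ a → p.degree < (minpoly Fq lam).natDegree := fun p hp =>
    degree_le_natDegree.trans_lt (by exact_mod_cast hp.trans_lt hat)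
  have hf0 : f ≠ 0 := by
    rintro rfl
    rw [map_zero, mul_eq_zero, or_iff_right hα] at h
    have := eq_zero_of_aeval_eq_zero (hlt g hg) h
    subst this
    exact not_isCoprime_zero_zero hfg
  have hg0 : g ≠ 0 := by
    rintro rfl
    rw [map_zero, mul_zero] at h
    exact hf0 (eq_zero_of_aeval_eq_zero (hlt f hf) h.symm)
  have hmap : powSpan Fq lam j ⊓ smulSub Fq α (powSpan Fq lam j) =
      (degreeLT Fq (j - a)).map ((aeval lam).toLinearMap ∘ₗ LinearMap.mulLeft Fq f) := by
    ext z
    simp only [Submodule.mem_inf, Submodule.mem_map, mem_smulSub, mem_degreeLT]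
    constructor
    · rintro ⟨hz, y, hy, hyz⟩
      obtain ⟨u, hu, rfl⟩ := mem_powSpan.1 hz
      obtain ⟨v, hv, rfl⟩ := mem_powSpan.1 hy
      have key : u * g - v * f = 0 := by
        refine eq_zero_of_aeval_eq_zero (lam := lam) ?_ ?_
        · exact (degree_sub_le _ _).trans_lt
            (max_lt (degree_mul_lt hu hg hj) (degree_mul_lt hv hf hj))
        · rw [map_sub, map_mul, map_mul, ← h, ← hyz]; ring
      have hdvd : f ∣ u := hfg.dvd_of_dvd_mul_right ⟨v, by rw [sub_eq_zero.1 key]; ring⟩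
      obtain ⟨w, rfl⟩ := hdvd
      have hv' : v = w * g := by
        apply mul_right_cancel₀ hf0
        rw [← sub_eq_zero.1 key]; ring
      subst hv'
      refine ⟨w, ?_, rfl⟩
      by_cases hw : w = 0
      · simp [hw, bot_lt_iff_ne_bot]
      rw [degree_mul, degree_eq_natDegree hf0, degree_eq_natDegree hw, ← Nat.cast_add,
        Nat.cast_lt] at hu
      rw [degree_mul, degree_eq_natDegree hg0, degree_eq_natDegree hw, ← Nat.cast_add,
        Nat.cast_lt] at hv
      rw [degree_eq_natDegree hw, Nat.cast_lt]
      omega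
    · rintro ⟨w, hw, rfl⟩
      have hdeg : ∀ p : Fq[X], p.natDegree ≤ a → (w * p).degree < j := by
        intro p hp
        by_cases hja : a ≤ j
        · exact degree_mul_lt hw hp (by omega)
        · rw [Nat.sub_eq_zero_of_le (by omega)] at hw
          have : w = 0 := by simpa using hw
          simp [this, bot_lt_iff_ne_bot]
      refine ⟨mem_powSpan.2 ⟨f * w, by rw [mul_comm]; exact hdeg f hf, rfl⟩,
        aeval lam (w * g), mem_powSpan.2 ⟨_, hdeg g hg, rfl⟩, ?_⟩
      simp only [LinearMap.comp_apply, LinearMap.mulLeft_apply, AlgHom.toLinearMap_apply, map_mul,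
        ← h]
      ring
  rw [hmap, finrank_map_of_injOn, finrank_degreeLT]
  intro w hw h0
  rw [mem_degreeLT] at hw
  have h1 : w * f = 0 := by
    refine eq_zero_of_aeval_eq_zero (lam := lam) (degree_mul_lt hw hf (by omega)) ?_
    rw [mul_comm]
    exact h0
  exact (mul_eq_zero.1 h1).resolve_right hf0

theorem exists_finrank_powSpan_inf {lam α : F} (hα : α ≠ 0) {M : ℕ}
    (hM : 2 * M ≤ (minpoly Fq lam).natDegree) :
    ∃ a ≤ M, ∀ j ≤ M,
      finrank Fq ↥(powSpan Fq lam j ⊓ smulSub Fq α (powSpan Fq lam j)) = j - a := by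
  classical
  by_cases hbot : powSpan Fq lam M ⊓ smulSub Fq α (powSpan Fq lam M) = ⊥
  · refine ⟨M, le_rfl, fun j hj => ?_⟩
    have hle : powSpan Fq lam j ≤ powSpan Fq lam M := by
      apply Submodule.span_mono
      rintro x ⟨i, hi, rfl⟩
      exact ⟨i, hi.trans_le hj, rfl⟩
    have : powSpan Fq lam j ⊓ smulSub Fq α (powSpan Fq lam j) = ⊥ :=
      le_bot_iff.1 (hbot ▸ inf_le_inf hle (Submodule.map_mono hle))
    rw [this, finrank_bot, Nat.sub_eq_zero_of_le hj]
  · obtain ⟨z, hz, hz0⟩ := Submodule.exists_mem_ne_zero_of_ne_bot hbot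
    obtain ⟨hz, hz'⟩ := hz
    obtain ⟨y, hy, hyz⟩ := (mem_smulSub Fq).1 hz'
    obtain ⟨u, hu, rfl⟩ := mem_powSpan.1 hz
    obtain ⟨v, hv, rfl⟩ := mem_powSpan.1 hy
    have hu0 : u ≠ 0 := by rintro rfl; simp at hz0
    have hv0 : v ≠ 0 := by rintro rfl; simp at hyz; exact hz0 hyz.symm
    have hcop := isCoprime_div_gcd_div_gcd (p := u) hv0
    set d := gcd u v
    have hud : u = d * (u / d) := (EuclideanDomain.mul_div_cancel' (gcd_ne_zero_of_right hv0)
      (gcd_dvd_left u v)).symm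
    have hvd : v = d * (v / d) := (EuclideanDomain.mul_div_cancel' (gcd_ne_zero_of_right hv0)
      (gcd_dvd_right u v)).symm
    set f := u / d
    set g := v / d
    have hfu : f.natDegree ≤ u.natDegree := natDegree_le_of_dvd ⟨d, by rw [mul_comm]; exact hud⟩ hu0
    have hgv : g.natDegree ≤ v.natDegree := natDegree_le_of_dvd ⟨d, by rw [mul_comm]; exact hvd⟩ hv0
    rw [degree_eq_natDegree hu0, Nat.cast_lt] at hu
    rw [degree_eq_natDegree hv0, Nat.cast_lt] at hv
    have hd0 : aeval lam d ≠ 0 := by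
      intro h0
      apply hz0
      rw [hud, map_mul, h0, zero_mul]
    have hrel : α * aeval lam g = aeval lam f := by
      apply mul_left_cancel₀ hd0
      rw [← map_mul, ← hud, ← hyz]
      conv_rhs => rw [hvd, map_mul]
      ring
    refine ⟨max f.natDegree g.natDegree, by omega, fun j hj => ?_⟩
    exact finrank_powSpan_inf_of_coprime hα hcop (le_max_left _ _) (le_max_right _ _)
      (by omega) (by omega) (by omega) hrel

end Poly

section Duality

variable {F : Type*} [Field F] {Fq : Subfield F}

theorem smulSub_inv_inf {α : F} (hα : α ≠ 0) (R : Submodule Fq F) :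
    finrank Fq ↥(R ⊓ smulSub Fq α⁻¹ R) = finrank Fq ↥(R ⊓ smulSub Fq α R) := by
  rw [← finrank_smulSub Fq hα (R ⊓ smulSub Fq α⁻¹ R)]
  suffices smulSub Fq α (R ⊓ smulSub Fq α⁻¹ R) = R ⊓ smulSub Fq α R by rw [this]
  ext x
  simp only [mem_smulSub, Submodule.mem_inf]
  constructor
  · rintro ⟨_, ⟨hy, z, hz, rfl⟩, rfl⟩
    rw [mul_inv_cancel_left₀ hα]
    exact ⟨hz, _, hy, mul_inv_cancel_left₀ hα _⟩
  · rintro ⟨hx, y, hy, rfl⟩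
    exact ⟨y, ⟨hy, _, hx, inv_mul_cancel_left₀ hα _⟩, rfl⟩

/-- If `S` and `R` are mutually orthogonal and of complementary dimension with respect to the form
`(x, y) ↦ ψ (x * y)`, the dimensions of `S ∩ αS` and `R ∩ αR` determine each other. -/
theorem finrank_inf_smulSub_of_orthogonal [FiniteDimensional Fq F] {ψ : F →ₗ[Fq] Fq} (hψ : ψ ≠ 0)
    {S R : Submodule Fq F} (hSR : ∀ x ∈ S, ∀ y ∈ R, ψ (x * y) = 0)
    (hdim : finrank Fq S + finrank Fq R = finrank Fq F) {α : F} (hα : α ≠ 0) :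
    finrank Fq ↥(S ⊓ smulSub Fq α S) + 2 * finrank Fq R =
      finrank Fq F + finrank Fq ↥(R ⊓ smulSub Fq α R) := by
  let B : LinearMap.BilinForm Fq F := (LinearMap.mul Fq F).compr₂ ψ
  have hB : ∀ x y, B x y = ψ (x * y) := fun _ _ => rfl
  have hsymm : ∀ x y, B x y = B y x := fun x y => by rw [hB, hB, mul_comm]
  have hleft : B.SeparatingLeft := by
    intro x hx
    by_contra hx0
    apply hψ
    ext z
    have := hx (x⁻¹ * z)
    rw [hB, mul_inv_cancel_left₀ hx0] at this
    simp [this]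
  have hnd : B.Nondegenerate :=
    ⟨hleft, fun x hx => hleft x fun y => by rw [hsymm]; exact hx y⟩
  have hS : S = B.orthogonal R := by
    apply Submodule.eq_of_le_of_finrank_eq
    · intro x hx
      rw [LinearMap.BilinForm.mem_orthogonal_iff]
      intro y hy
      rw [hsymm]
      exact hSR x hx y hy
    · rw [LinearMap.BilinForm.finrank_orthogonal hnd]; omega
  have hmem : ∀ x, x ∈ S ↔ ∀ y ∈ R, ψ (x * y) = 0 := by
    intro x
    conv_lhs => rw [hS]
    simp only [LinearMap.BilinForm.mem_orthogonal_iff, hB, mul_comm]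
  have hinf : S ⊓ smulSub Fq α S = B.orthogonal (R ⊔ smulSub Fq α⁻¹ R) := by
    ext x
    simp only [LinearMap.BilinForm.mem_orthogonal_iff, Submodule.mem_inf, hB]
    constructor
    · rintro ⟨hx, hx'⟩ y hy
      obtain ⟨y, hyR, z, hz, rfl⟩ := Submodule.mem_sup.1 hy
      obtain ⟨z, hzR, rfl⟩ := (mem_smulSub Fq).1 hz
      obtain ⟨w, hw, rfl⟩ := (mem_smulSub Fq).1 hx'
      have h1 := (hmem _).1 hx y hyR
      have h2 := (hmem _).1 hw z hzR
      have : (y + α⁻¹ * z) * (α * w) = α * w * y + w * z := by field_simp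
      rw [this, map_add, h1, h2, add_zero]
    · intro h
      refine ⟨(hmem x).2 fun y hy => ?_, (mem_smulSub Fq).2
        ⟨α⁻¹ * x, (hmem _).2 fun y hy => ?_, mul_inv_cancel_left₀ hα x⟩⟩
      · rw [mul_comm]
        exact h y (Submodule.mem_sup_left hy)
      · rw [mul_right_comm]
        exact h _ (Submodule.mem_sup_right ((mem_smulSub Fq).2 ⟨y, hy, rfl⟩))
  have h1 := LinearMap.BilinForm.finrank_orthogonal hnd (R ⊔ smulSub Fq α⁻¹ R)
  have h2 := Submodule.finrank_sup_add_finrank_inf_eq R (smulSub Fq α⁻¹ R)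
  have h3 := Submodule.finrank_le (R ⊔ smulSub Fq α⁻¹ R)
  rw [finrank_smulSub Fq (inv_ne_zero hα), smulSub_inv_inf hα] at h2
  rw [hinf, h1]
  omega

end Duality

section Tower

variable {F : Type*} [Field F] {Fq Fqt : Subfield F} (hle : Fq ≤ Fqt)

theorem finrank_toFqSub (W : Submodule Fqt F) :
    finrank Fq (toFqSub Fq Fqt hle W) =
      finrank Fq (subfieldModule Fq Fqt hle) * finrank Fqt W := by
  let _ : Algebra Fq Fqt := (Subfield.inclusion hle).toAlgebra
  have : IsScalarTower Fq Fqt F := .of_algebraMap_eq fun _ => rfl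
  have h := finrank_mul_finrank Fq Fqt W
  exact h.symm

theorem exists_notMem_of_finrank_ne_one (h : finrank Fqt F ≠ 1) : ∃ θ : F, θ ∉ Fqt := by
  by_contra! hall
  apply h
  have := finrank_eq_one_iff_of_nonzero' (K := Fqt) (1 : F) one_ne_zero
  exact this.2 fun w => ⟨⟨w, hall w⟩, by simp [Subfield.smul_def]⟩

end Tower

section Count

open Finset

variable {F : Type*} [Field F] {Fq : Subfield F}

theorem sum_pow_finrank_inf_smulSub [Fintype F] [DecidableEq F] (P : Submodule Fq F) {q : ℕ}
    (hq : Nat.card Fq = q) :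
    ∑ α ∈ univ.filter (fun α : F => α ≠ 0), (q ^ finrank Fq ↥(P ⊓ smulSub Fq α P) - 1) =
      (q ^ finrank Fq P - 1) ^ 2 := by
  classical
  have hcard : ∀ Q : Submodule Fq F,
      (univ.filter fun x : F => x ∈ Q ∧ x ≠ 0).card = q ^ finrank Fq Q - 1 := by
    intro Q
    rw [← hq, ← natCard_eq_pow_finrank, Nat.card_eq_fintype_card, Fintype.card_subtype,
      ← filter_filter, ← erase_eq_of_notMem (a := (0 : F)) (s := filter (fun x => x ≠ 0) _) (by simp),
      filter_ne', erase_idem, card_erase_of_mem (by simp)]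
  rw [sq, ← hcard P, ← card_product, card_eq_sum_card_fiberwise (f := fun p : F × F => p.1 / p.2)
    (t := univ.filter (fun α : F => α ≠ 0))]
  · refine sum_congr rfl fun α hα => ?_
    have hα0 : α ≠ 0 := by simpa using hα
    rw [← hcard]
    refine card_bij (fun x _ => (x, x / α)) ?_ ?_ ?_
    · intro x hx
      simp only [mem_filter, mem_univ, true_and, Submodule.mem_inf, mem_smulSub] at hx
      obtain ⟨⟨hx, y, hy, rfl⟩, h0⟩ := hx
      have hy0 : y ≠ 0 := right_ne_zero_of_mul h0
      simp only [mem_filter, mem_product, mem_univ, true_and]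
      rw [mul_div_cancel_left₀ _ hα0]
      exact ⟨⟨⟨hx, h0⟩, hy, hy0⟩, mul_div_cancel_right₀ _ hy0⟩
    · intro x _ y _ h
      exact (Prod.ext_iff.1 h).1
    · rintro ⟨x, y⟩ h
      simp only [mem_filter, mem_product, mem_univ, true_and] at h
      obtain ⟨⟨⟨hx, hx0⟩, hy, hy0⟩, rfl⟩ := h
      refine ⟨x, ?_, ?_⟩
      · simp only [mem_filter, mem_univ, true_and, Submodule.mem_inf, mem_smulSub]
        exact ⟨⟨hx, y, hy, by field_simp⟩, hx0⟩
      · simp only [Prod.mk.injEq, true_and]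
        field_simp
  · rintro ⟨x, y⟩ h
    simp only [coe_product, coe_filter, Set.mem_prod, Set.mem_ofPred_eq, mem_univ, true_and] at h ⊢
    exact div_ne_zero h.1.2 h.2.2

/-- The number of rational functions of degree `i` over a field with `q` elements, zero excluded. -/
def ratCount (q i : ℕ) : ℕ := if i = 0 then q - 1 else (q ^ 2 - 1) * q ^ (2 * i - 1)

theorem cast_ratCount_succ {q : ℕ} (hq : 1 ≤ q) (i : ℕ) :
    (ratCount q (i + 1) : ℤ) = ((q : ℤ) ^ 2 - 1) * q ^ (2 * i + 1) := by
  have : 1 ≤ q ^ 2 := Nat.one_le_pow _ _ hq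
  simp only [ratCount, Nat.add_eq_zero_iff, one_ne_zero, and_false, if_false]
  push_cast [this]
  rfl

theorem sum_ratCount {q : ℕ} (hq : 1 ≤ q) (N : ℕ) :
    ∑ i ∈ range (N + 1), (ratCount q i : ℤ) = (q : ℤ) ^ (2 * N + 1) - 1 := by
  induction N with
  | zero => simp [ratCount, Nat.cast_sub hq]
  | succ N ih =>
    rw [sum_range_succ, ih, cast_ratCount_succ hq]
    ring

theorem sum_ratCount_mul_pow {q : ℕ} (hq : 1 ≤ q) (N : ℕ) :
    ∑ i ∈ range (N + 1), (ratCount q i : ℤ) * q ^ (N + 1 - i) =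
      (q : ℤ) ^ (2 * N + 2) - 2 * q ^ (N + 1) + q ^ (2 * N + 1) := by
  induction N with
  | zero => simp [ratCount, Nat.cast_sub hq]; ring
  | succ N ih =>
    rw [sum_range_succ, cast_ratCount_succ hq]
    have : ∑ i ∈ range (N + 1), (ratCount q i : ℤ) * q ^ (N + 1 + 1 - i) =
        (∑ i ∈ range (N + 1), (ratCount q i : ℤ) * q ^ (N + 1 - i)) * q := by
      rw [sum_mul]
      refine sum_congr rfl fun i hi => ?_
      rw [Nat.sub_add_comm (by have := mem_range.1 hi; omega), pow_succ]
      ring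
    rw [this, ih]
    simp only [add_tsub_cancel_left]
    ring

theorem sum_ratCount_mul {q : ℕ} (hq : 1 ≤ q) (N : ℕ) :
    ∑ i ∈ range (N + 1), (ratCount q i : ℤ) * (q ^ (N + 1 - i) - 1) =
      ((q : ℤ) ^ (N + 1) - 1) ^ 2 := by
  simp only [mul_sub, mul_one, sum_sub_distrib, sum_ratCount hq, sum_ratCount_mul_pow hq]
  ring

theorem card_filter_finrank_powSpan [Fintype F] [DecidableEq F] {q : ℕ} (hq : Nat.card Fq = q)
    (hq2 : 2 ≤ q) {lam : F} {M : ℕ} (hM : 2 * M ≤ (minpoly Fq lam).natDegree) {i : ℕ} (hi : i < M) :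
    (univ.filter fun α : F => α ≠ 0 ∧
      finrank Fq ↥(powSpan Fq lam M ⊓ smulSub Fq α (powSpan Fq lam M)) = M - i).card =
      ratCount q i := by
  have hex : ∀ α : F, ∃ a, α ≠ 0 → a ≤ M ∧ ∀ j ≤ M,
      finrank Fq ↥(powSpan Fq lam j ⊓ smulSub Fq α (powSpan Fq lam j)) = j - a := by
    intro α
    by_cases hα : α = 0
    · exact ⟨0, fun h => absurd hα h⟩
    · obtain ⟨a, ha⟩ := exists_finrank_powSpan_inf hα hM
      exact ⟨a, fun _ => ha⟩
  choose a ha using hex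
  have hset : ∀ i < M, (univ.filter fun α : F => α ≠ 0 ∧
      finrank Fq ↥(powSpan Fq lam M ⊓ smulSub Fq α (powSpan Fq lam M)) = M - i) =
      (univ.filter fun α : F => α ≠ 0).filter fun α => a α = i := by
    intro i hi
    rw [filter_filter]
    refine filter_congr fun α _ => and_congr_right fun hα => ?_
    rw [(ha α hα).2 M le_rfl]
    have := (ha α hα).1
    omega
  rw [hset i hi]
  have hsum : ∀ j < M, ∑ i ∈ range (j + 1),
      (((univ.filter fun α : F => α ≠ 0).filter fun α => a α = i).card : ℤ) *
        (q ^ (j + 1 - i) - 1) = ((q : ℤ) ^ (j + 1) - 1) ^ 2 := by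
    intro j hj
    have h := sum_pow_finrank_inf_smulSub (powSpan Fq lam (j + 1)) hq
    rw [finrank_powSpan (by omega)] at h
    have h1 : ∀ e : ℕ, 1 ≤ q ^ e := fun e => Nat.one_le_pow _ _ (by omega)
    zify [h1] at h
    rw [← h]
    have h2 : ∀ α ∈ univ.filter (fun α : F => α ≠ 0),
        (q : ℤ) ^ finrank Fq ↥(powSpan Fq lam (j + 1) ⊓ smulSub Fq α (powSpan Fq lam (j + 1))) - 1
          = q ^ (j + 1 - a α) - 1 := fun α hα => by
      rw [(ha α (by simpa using hα)).2 (j + 1) hj]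
    rw [sum_congr rfl h2, ← sum_filter_add_sum_filter_not _ (fun α => a α < j + 1)]
    rw [sum_eq_zero (s := filter (fun α => ¬ a α < j + 1) _), add_zero]
    · rw [← sum_fiberwise_of_maps_to (g := a) (t := range (j + 1))]
      · refine sum_congr rfl fun i hi => ?_
        have hi' := mem_range.1 hi
        rw [sum_congr rfl (g := fun _ => (q : ℤ) ^ (j + 1 - i) - 1)]
        · have hall := filter_true_of_mem (p := fun α => a α < j + 1)
            (s := (univ.filter fun α : F => α ≠ 0).filter fun α => a α = i) fun α hα => by
              rwa [(mem_filter.1 hα).2]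
          rw [sum_const, nsmul_eq_mul, filter_comm (fun α => a α < j + 1), hall]
        · intro α hα
          rw [(mem_filter.1 hα).2]
      · intro α hα
        exact mem_range.2 (mem_filter.1 hα).2
    · intro α hα
      have := (mem_filter.1 hα).2
      rw [Nat.sub_eq_zero_of_le (by omega), pow_zero, sub_self]
  induction i using Nat.strong_induction_on with
  | _ i ih =>
    have h := hsum i hi
    rw [← sum_ratCount_mul (by omega) i, sum_range_succ, sum_range_succ] at h
    have hlow : ∀ j ∈ range i,
        (((univ.filter fun α : F => α ≠ 0).filter fun α => a α = j).card : ℤ) *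
          (q ^ (i + 1 - j) - 1) = (ratCount q j : ℤ) * (q ^ (i + 1 - j) - 1) := fun j hj => by
      rw [ih j (mem_range.1 hj) (by have := mem_range.1 hj; omega)]
    rw [sum_congr rfl hlow, add_right_inj, add_tsub_cancel_left, pow_one] at h
    have hq0 : ((q : ℤ) - 1) ≠ 0 := by omega
    exact_mod_cast mul_right_cancel₀ hq0 h

end Count

section Orbit

variable {F : Type*} [Field F] {Fq : Subfield F}

theorem smulSub_smulSub (α β : F) (S : Submodule Fq F) :
    smulSub Fq α (smulSub Fq β S) = smulSub Fq (α * β) S := by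
  ext x
  simp only [mem_smulSub]
  constructor
  · rintro ⟨_, ⟨y, hy, rfl⟩, rfl⟩
    exact ⟨y, hy, mul_assoc _ _ _⟩
  · rintro ⟨y, hy, rfl⟩
    exact ⟨_, ⟨y, hy, rfl⟩, (mul_assoc _ _ _).symm⟩

theorem smulSub_one (S : Submodule Fq F) : smulSub Fq 1 S = S := by
  ext x
  simp [mem_smulSub]

theorem smulSub_div_eq_self {α β : F} (hβ : β ≠ 0) {S : Submodule Fq F}
    (h : smulSub Fq α S = smulSub Fq β S) : smulSub Fq (α / β) S = S := by
  rw [div_eq_inv_mul, ← smulSub_smulSub, h, smulSub_smulSub, inv_mul_cancel₀ hβ, smulSub_one]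

theorem smulSub_coe (c : Fq) (hc : c ≠ 0) (S : Submodule Fq F) : smulSub Fq (c : F) S = S := by
  have hle : ∀ c : Fq, smulSub Fq (c : F) S ≤ S := by
    intro c x hx
    obtain ⟨y, hy, rfl⟩ := (mem_smulSub Fq).1 hx
    exact S.smul_mem c hy
  refine le_antisymm (hle c) fun x hx => ?_
  have hc' : (c : F) ≠ 0 := by simpa using hc
  refine (mem_smulSub Fq).2 ⟨((c⁻¹ : Fq) : F) * x, S.smul_mem _ hx, ?_⟩
  rw [Subfield.coe_inv, mul_inv_cancel_left₀ hc']

theorem wt_eq_zero_of_family [Infinite Fq] {S : Submodule Fq F} {d : ℕ} (f : Fq → F)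
    (hf0 : ∀ c, f c ≠ 0) (hf : ∀ c, finrank Fq ↥(S ⊓ smulSub Fq (f c) S) = d)
    (hdiv : ∀ c c', c ≠ c' → finrank Fq ↥(S ⊓ smulSub Fq (f c / f c') S) ≠ finrank Fq S) :
    wt Fq S d = 0 := by
  apply Set.Infinite.ncard
  refine Set.infinite_of_injective_forall_mem (f := fun c => smulSub Fq (f c) S) ?_ ?_
  · intro c c' h
    by_contra hne
    apply hdiv c c' hne
    rw [smulSub_div_eq_self (hf0 c') h, inf_idem]
  · exact fun c => ⟨⟨f c, hf0 c, rfl⟩, hf c⟩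

theorem wt_eq_zero_of_forall_ne {S : Submodule Fq F} {d : ℕ}
    (h : ∀ α : F, α ≠ 0 → finrank Fq ↥(S ⊓ smulSub Fq α S) ≠ d) : wt Fq S d = 0 := by
  have hempty : {T | T ∈ Orb Fq S ∧ finrank Fq ↥(S ⊓ T) = d} = ∅ := by
    refine Set.eq_empty_of_forall_notMem ?_
    rintro T ⟨⟨α, hα, rfl⟩, hT⟩
    exact h α hα hT
  rw [wt, hempty, Set.ncard_empty]

/-- If the intersection dimension is `d` for all multipliers outside a proper intermediate field,
and `S` itself does not have dimension `d`, infinitely many `αS` meet `S` in dimension `d`. -/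
theorem wt_eq_zero_of_notMem [Infinite Fq] {Fqt : Subfield F} (hle : Fq ≤ Fqt) {θ : F}
    (hθ : θ ∉ Fqt) {S : Submodule Fq F} {d : ℕ}
    (h : ∀ γ : F, γ ∉ Fqt → finrank Fq ↥(S ⊓ smulSub Fq γ S) = d) (hS : finrank Fq S ≠ d) :
    wt Fq S d = 0 := by
  have hmem : ∀ c : Fq, θ + c ∉ Fqt := fun c hc => hθ (by simpa using Fqt.sub_mem hc (hle c.2))
  have hne : ∀ c : Fq, θ + c ≠ 0 := fun c hc => hmem c (hc ▸ Fqt.zero_mem)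
  refine wt_eq_zero_of_family (fun c => θ + c) hne (fun c => h _ (hmem c)) fun c c' hcc => ?_
  rw [h]
  · exact hS.symm
  intro hγ
  set γ := (θ + c) / (θ + c')
  have hrel : γ * (θ + c') = θ + c := div_mul_cancel₀ _ (hne c')
  by_cases h1 : γ = 1
  · rw [h1, one_mul, add_right_inj] at hrel
    exact hcc (Subtype.ext hrel.symm)
  · apply hθ
    have : θ = (c - γ * c') / (γ - 1) := by
      rw [eq_div_iff (sub_ne_zero.2 h1)]
      linear_combination hrel
    rw [this]
    exact Fqt.div_mem (Fqt.sub_mem (hle c.2) (Fqt.mul_mem hγ (hle c'.2)))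
      (Fqt.sub_mem hγ Fqt.one_mem)

theorem wt_mul_eq_card [Fintype F] [DecidableEq F] {q : ℕ} (hq : Nat.card Fq = q)
    {S : Submodule Fq F} (hstab : ∀ α : F, α ≠ 0 → smulSub Fq α S = S → α ∈ Fq) (d : ℕ) :
    wt Fq S d * (q - 1) = (Finset.univ.filter fun α : F => α ≠ 0 ∧
      finrank Fq ↥(S ⊓ smulSub Fq α S) = d).card := by
  classical
  have hset : {T | T ∈ Orb Fq S ∧ finrank Fq ↥(S ⊓ T) = d} =
      (((Finset.univ.filter fun α : F => α ≠ 0 ∧ finrank Fq ↥(S ⊓ smulSub Fq α S) = d).image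
        fun α => smulSub Fq α S : Finset (Submodule Fq F)) : Set (Submodule Fq F)) := by
    ext T
    simp only [Orb, Finset.coe_image, Finset.coe_filter, Finset.mem_univ, true_and, Set.mem_image,
      Set.mem_ofPred_eq]
    constructor
    · rintro ⟨⟨α, hα, rfl⟩, hT⟩
      exact ⟨α, ⟨hα, hT⟩, rfl⟩
    · rintro ⟨α, ⟨hα, hT⟩, rfl⟩
      exact ⟨⟨α, hα, rfl⟩, hT⟩
  rw [wt, hset, Set.ncard_coe_finset,
    Finset.card_eq_sum_card_image (fun α => smulSub Fq α S), Finset.sum_const_nat]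
  intro T hT
  obtain ⟨β, hβ, rfl⟩ := Finset.mem_image.1 hT
  obtain ⟨-, hβ0, hβd⟩ := Finset.mem_filter.1 hβ
  have hcard : (Finset.univ.filter fun c : Fq => c ≠ 0).card = q - 1 := by
    rw [Finset.filter_ne', Finset.card_erase_of_mem (Finset.mem_univ _), Finset.card_univ, ← hq,
      Nat.card_eq_fintype_card]
  rw [← hcard]
  symm
  refine Finset.card_bij (fun c _ => β * c) ?_ ?_ ?_
  · intro c hc
    have hc0 : c ≠ 0 := by simpa using hc
    have heq : smulSub Fq (β * c) S = smulSub Fq β S := by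
      rw [← smulSub_smulSub, smulSub_coe c hc0]
    refine Finset.mem_filter.2 ⟨Finset.mem_filter.2 ⟨Finset.mem_univ _, ?_⟩, heq⟩
    exact ⟨mul_ne_zero hβ0 fun h => hc0 (Subtype.ext h), by rw [heq, hβd]⟩
  · intro c _ c' _ h
    exact Subtype.ext (mul_left_cancel₀ hβ0 h)
  · intro α hα
    obtain ⟨hα, hαβ⟩ := Finset.mem_filter.1 hα
    obtain ⟨-, hα0, -⟩ := Finset.mem_filter.1 hα
    refine ⟨⟨α / β, hstab _ (div_ne_zero hα0 hβ0) (smulSub_div_eq_self hβ0 hαβ)⟩, ?_,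
      mul_div_cancel₀ _ hβ0⟩
    simp only [ne_eq, Finset.mem_filter, Finset.mem_univ, true_and]
    intro h
    exact div_ne_zero hα0 hβ0 (congrArg Subtype.val h)

end Orbit

section Hyperplane

variable {F : Type*} [Field F] {Fq Fqt : Subfield F} {hle : Fq ≤ Fqt} {Sbar : Submodule Fqt F}
  {b : F}

theorem mem_toFqSub {W : Submodule Fqt F} {x : F} : x ∈ toFqSub Fq Fqt hle W ↔ x ∈ W := Iff.rfl

theorem mem_subfieldModule {x : F} : x ∈ subfieldModule Fq Fqt hle ↔ x ∈ Fqt := Iff.rfl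

theorem mul_mem_right {W : Submodule Fqt F} {x c : F} (hx : x ∈ W) (hc : c ∈ Fqt) : x * c ∈ W := by
  rw [mul_comm]
  exact W.smul_mem ⟨c, hc⟩ hx

theorem powSpan_le_subfieldModule {lam : F} (hmem : lam ∈ Fqt) (j : ℕ) :
    powSpan Fq lam j ≤ subfieldModule Fq Fqt hle := by
  refine Submodule.span_le.2 ?_
  rintro x ⟨i, -, rfl⟩
  exact Fqt.pow_mem hmem i

theorem eq_zero_of_mul_mem (hb : b ≠ 0)
    (hbint : {x : F | ∃ c ∈ Fqt, x = b * c} ∩ (Sbar : Set F) = {0}) {c : F} (hc : c ∈ Fqt)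
    (h : b * c ∈ Sbar) : c = 0 := by
  have : b * c ∈ ({0} : Set F) := hbint ▸ ⟨⟨c, hc, rfl⟩, h⟩
  simpa [hb] using this

theorem finrank_eq_add_one (hb : b ≠ 0)
    (hbint : {x : F | ∃ c ∈ Fqt, x = b * c} ∩ (Sbar : Set F) = {0})
    (hY : toFqSub Fq Fqt hle Sbar ⊔ smulSub Fq b (subfieldModule Fq Fqt hle) = ⊤)
    (hl : 0 < finrank Fqt Sbar) : finrank Fqt F = finrank Fqt Sbar + 1 := by
  have : FiniteDimensional Fqt Sbar := .of_finrank_pos hl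
  have hsup : Sbar ⊔ Submodule.span Fqt {b} = ⊤ := by
    rw [eq_top_iff]
    intro x _
    have hx : x ∈ toFqSub Fq Fqt hle Sbar ⊔ smulSub Fq b (subfieldModule Fq Fqt hle) :=
      hY ▸ Submodule.mem_top
    obtain ⟨s, hs, y, hy, rfl⟩ := Submodule.mem_sup.1 hx
    obtain ⟨c, hc, rfl⟩ := (mem_smulSub Fq).1 hy
    exact Submodule.add_mem_sup hs (mul_mem_right (Submodule.mem_span_singleton_self b) hc)
  have hinf : Sbar ⊓ Submodule.span Fqt {b} = ⊥ := by
    rw [eq_bot_iff]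
    rintro x ⟨hx, hx'⟩
    obtain ⟨c, rfl⟩ := Submodule.mem_span_singleton.1 hx'
    have hcb : c • b = b * c := by rw [Subfield.smul_def, smul_eq_mul, mul_comm]
    have : (c : F) = 0 := eq_zero_of_mul_mem hb hbint c.2 (hcb ▸ hx)
    rw [hcb, this, mul_zero]
    exact Submodule.zero_mem _
  have h := Submodule.finrank_sup_add_finrank_inf_eq Sbar (Submodule.span Fqt {b})
  rwa [hsup, hinf, finrank_bot, finrank_top, finrank_span_singleton hb, add_zero] at h

theorem finrank_eq_mul (hle : Fq ≤ Fqt) :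
    finrank Fq F = finrank Fq (subfieldModule Fq Fqt hle) * finrank Fqt F := by
  have h := finrank_toFqSub hle (⊤ : Submodule Fqt F)
  have htop : toFqSub Fq Fqt hle ⊤ = ⊤ := rfl
  rwa [htop, finrank_top, finrank_top] at h

theorem finrank_sup_smulSub_powSpan [FiniteDimensional Fq F] (hb : b ≠ 0)
    (hbint : {x : F | ∃ c ∈ Fqt, x = b * c} ∩ (Sbar : Set F) = {0}) {lam : F} (hmem : lam ∈ Fqt)
    {m : ℕ} (hm : m ≤ (minpoly Fq lam).natDegree) :
    finrank Fq ↥(toFqSub Fq Fqt hle Sbar ⊔ smulSub Fq b (powSpan Fq lam m)) =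
      finrank Fq (subfieldModule Fq Fqt hle) * finrank Fqt Sbar + m := by
  have h := Submodule.finrank_sup_add_finrank_inf_eq (toFqSub Fq Fqt hle Sbar)
    (smulSub Fq b (powSpan Fq lam m))
  have hinf : toFqSub Fq Fqt hle Sbar ⊓ smulSub Fq b (powSpan Fq lam m) = ⊥ := by
    rw [eq_bot_iff]
    rintro x ⟨hx, hx'⟩
    obtain ⟨c, hc, rfl⟩ := (mem_smulSub Fq).1 hx'
    rw [eq_zero_of_mul_mem hb hbint
      (mem_subfieldModule.1 (powSpan_le_subfieldModule (hle := hle) hmem m hc)) hx, mul_zero]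
    exact Submodule.zero_mem _
  rwa [hinf, finrank_bot, add_zero, finrank_smulSub Fq hb, finrank_powSpan hm,
    finrank_toFqSub] at h

/-- The intersection dimensions of `S = Sbar + b⟨1, …, lam^(m-1)⟩` in terms of those of
`⟨1, …, lam^(t-m-1)⟩`. -/
theorem finrank_inf_smulSub [FiniteDimensional Fq F] (hb : b ≠ 0)
    (hbint : {x : F | ∃ c ∈ Fqt, x = b * c} ∩ (Sbar : Set F) = {0})
    (hY : toFqSub Fq Fqt hle Sbar ⊔ smulSub Fq b (subfieldModule Fq Fqt hle) = ⊤)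
    (hl : 0 < finrank Fqt Sbar) {lam : F} (hmem : lam ∈ Fqt)
    {t : ℕ} (ht : t = (minpoly Fq lam).natDegree)
    (hT : finrank Fq (subfieldModule Fq Fqt hle) = t) {m : ℕ} (hm : m < t) {S : Submodule Fq F}
    (hS : S = toFqSub Fq Fqt hle Sbar ⊔ smulSub Fq b (powSpan Fq lam m)) {α : F} (hα : α ≠ 0) :
    finrank Fq ↥(S ⊓ smulSub Fq α S) = t * (finrank Fqt Sbar - 1) + 2 * m +
      finrank Fq ↥(powSpan Fq lam (t - m) ⊓ smulSub Fq α (powSpan Fq lam (t - m))) := by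
  obtain ⟨r, hr⟩ : ∃ r, finrank Fqt Sbar = r + 1 := ⟨_, (Nat.sub_add_cancel hl).symm⟩
  have hF : finrank Fq F = t * r + 2 * t := by
    rw [finrank_eq_mul hle, finrank_eq_add_one hb hbint hY hl, hT, hr]; ring
  have hdS := finrank_sup_smulSub_powSpan (hle := hle) hb hbint hmem (m := m) (by omega)
  have hdV := finrank_sup_smulSub_powSpan (hle := hle) hb hbint hmem (m := t - 1) (by omega)
  rw [hT, hr, mul_add, mul_one] at hdS hdV
  rw [← hS] at hdS
  set V := toFqSub Fq Fqt hle Sbar ⊔ smulSub Fq b (powSpan Fq lam (t - 1))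
  have hVtop : V < ⊤ := by
    rw [lt_top_iff_ne_top]
    intro h
    rw [h, finrank_top] at hdV
    omega
  obtain ⟨ψ, hψ, hker⟩ := Submodule.exists_le_ker_of_lt_top V hVtop
  have hR : finrank Fq (powSpan Fq lam (t - m)) = t - m := finrank_powSpan (by omega)
  have h := finrank_inf_smulSub_of_orthogonal hψ (S := S) (R := powSpan Fq lam (t - m)) ?_
    (by rw [hdS, hR, hF]; omega) hα
  · rw [hR, hF] at h
    rw [hr, Nat.add_sub_cancel]
    omega
  · intro x hx y hy
    apply hker
    rw [hS] at hx
    obtain ⟨s, hs, z, hz, rfl⟩ := Submodule.mem_sup.1 hx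
    obtain ⟨c, hc, rfl⟩ := (mem_smulSub Fq).1 hz
    rw [add_mul, mul_assoc]
    refine Submodule.add_mem_sup ?_ ?_
    · exact mul_mem_right (W := Sbar) hs
        (mem_subfieldModule.1 (powSpan_le_subfieldModule (hle := hle) hmem _ hy))
    · exact (mem_smulSub Fq).2 ⟨_, mul_mem_powSpan hc hy (by omega), rfl⟩

theorem finrank_powSpan_inf_of_notMem {lam α : F} (hle : Fq ≤ Fqt) (hmem : lam ∈ Fqt)
    (hα : α ∉ Fqt) (j : ℕ) :
    finrank Fq ↥(powSpan Fq lam j ⊓ smulSub Fq α (powSpan Fq lam j)) = 0 := by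
  have hle' := powSpan_le_subfieldModule (hle := hle) hmem j
  suffices powSpan Fq lam j ⊓ smulSub Fq α (powSpan Fq lam j) = ⊥ by rw [this, finrank_bot]
  rw [eq_bot_iff]
  rintro x ⟨hx, hx'⟩
  obtain ⟨y, hy, rfl⟩ := (mem_smulSub Fq).1 hx'
  by_cases hy0 : y = 0
  · simp [hy0]
  · refine absurd ?_ hα
    have := Fqt.div_mem (mem_subfieldModule.1 (hle' hx)) (mem_subfieldModule.1 (hle' hy))
    rwa [mul_div_cancel_right₀ _ hy0] at this

end Hyperplane

section InfiniteField

variable {F : Type*} [Field F] {Fq Fqt : Subfield F} {hle : Fq ≤ Fqt} {Sbar : Submodule Fqt F}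
  {b : F}

theorem natDegree_dvd_finrank_subfieldModule (hle : Fq ≤ Fqt) {lam : F} (hmem : lam ∈ Fqt)
    (ht : 0 < (minpoly Fq lam).natDegree) :
    (minpoly Fq lam).natDegree ∣ finrank Fq (subfieldModule Fq Fqt hle) := by
  let _ : Algebra Fq Fqt := (Subfield.inclusion hle).toAlgebra
  have : IsScalarTower Fq Fqt F := .of_algebraMap_eq fun _ => rfl
  have hmin : minpoly Fq lam = minpoly Fq (⟨lam, hmem⟩ : Fqt) :=
    minpoly.algebraMap_eq (A := Fq) (B' := F) (algebraMap Fqt F).injective (⟨lam, hmem⟩ : Fqt)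
  rw [hmin] at ht ⊢
  have hint : IsIntegral Fq (⟨lam, hmem⟩ : Fqt) := by
    by_contra h
    rw [minpoly.eq_zero h, Polynomial.natDegree_zero] at ht
    exact lt_irrefl _ ht
  exact minpoly.degree_dvd hint

theorem finrank_subfieldModule_le {W : Submodule Fqt F} (hW : W ≠ ⊥) {U : Submodule Fq F}
    (hU : 0 < finrank Fq U) (hWU : toFqSub Fq Fqt hle W ≤ U) :
    0 < finrank Fq (subfieldModule Fq Fqt hle) ∧
      finrank Fq (subfieldModule Fq Fqt hle) ≤ finrank Fq U := by
  have : FiniteDimensional Fq U := .of_finrank_pos hU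
  have : FiniteDimensional Fq (toFqSub Fq Fqt hle W) := Submodule.finiteDimensional_of_le hWU
  have hle' := Submodule.finrank_mono hWU
  have hpos : 0 < finrank Fq (toFqSub Fq Fqt hle W) := by
    obtain ⟨x, hx, hx0⟩ := Submodule.exists_mem_ne_zero_of_ne_bot hW
    rw [finrank_pos_iff_exists_ne_zero]
    exact ⟨⟨x, hx⟩, fun h => hx0 (congrArg Subtype.val h)⟩
  rw [finrank_toFqSub] at hle' hpos
  obtain ⟨hT, hW'⟩ := CanonicallyOrderedAdd.mul_pos.1 hpos
  exact ⟨hT, (Nat.le_mul_of_pos_right _ hW').trans hle'⟩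

theorem toFqSub_inf_le {lam α : F} {m : ℕ} {S : Submodule Fq F}
    (hS : S = toFqSub Fq Fqt hle Sbar ⊔ smulSub Fq b (powSpan Fq lam m)) :
    toFqSub Fq Fqt hle (Sbar ⊓ smulSub Fqt α Sbar) ≤ S ⊓ smulSub Fq α S := by
  rintro x ⟨hx, hx'⟩
  obtain ⟨y, hy, rfl⟩ := (mem_smulSub Fqt).1 hx'
  have hSS : ∀ z ∈ Sbar, z ∈ S := fun z hz => hS ▸ Submodule.mem_sup_left hz
  exact ⟨hSS _ hx, (mem_smulSub Fq).2 ⟨y, hSS y hy, rfl⟩⟩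

theorem inf_smulSub_eq_bot (hH : HStabSet (Sbar : Set F) = (Fqt : Set F))
    (hl : finrank Fqt Sbar = 1) {α : F} (hα : α ∉ Fqt) : Sbar ⊓ smulSub Fqt α Sbar = ⊥ := by
  have hα0 : α ≠ 0 := fun h => hα (h ▸ Fqt.zero_mem)
  have : FiniteDimensional Fqt Sbar := .of_finrank_pos (by omega)
  have hl' : finrank Fqt (smulSub Fqt α Sbar) = 1 := by rw [finrank_smulSub Fqt hα0, hl]
  have : FiniteDimensional Fqt (smulSub Fqt α Sbar) := .of_finrank_pos (by omega)
  by_contra hne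
  have hpos : 1 ≤ finrank Fqt ↥(Sbar ⊓ smulSub Fqt α Sbar) := Submodule.one_le_finrank_iff.2 hne
  have h1 := Submodule.eq_of_le_of_finrank_le
    (inf_le_left : Sbar ⊓ smulSub Fqt α Sbar ≤ Sbar) (by omega)
  have h2 := Submodule.eq_of_le_of_finrank_le
    (inf_le_right : Sbar ⊓ smulSub Fqt α Sbar ≤ smulSub Fqt α Sbar) (by omega)
  apply hα
  rw [← SetLike.mem_coe, ← hH]
  refine Or.inl ⟨hα0, ?_⟩
  have h3 : ((smulSub Fqt α Sbar : Submodule Fqt F) : Set F) = Sbar := by rw [← h2, h1]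
  exact h3

/-- For a line `Sbar` in a plane, the intersection of `S` and `αS` is the direct sum of two copies
of the span of the powers of `lam`, unless `α` stabilizes the line. -/
theorem finrank_inf_smulSub_of_notMem (hb : b ≠ 0)
    (hbint : {x : F | ∃ c ∈ Fqt, x = b * c} ∩ (Sbar : Set F) = {0})
    (hY : toFqSub Fq Fqt hle Sbar ⊔ smulSub Fq b (subfieldModule Fq Fqt hle) = ⊤)
    (hH : HStabSet (Sbar : Set F) = (Fqt : Set F)) (hl : finrank Fqt Sbar = 1)
    {lam : F} (hmem : lam ∈ Fqt) {m : ℕ} (hm : m ≤ (minpoly Fq lam).natDegree)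
    {S : Submodule Fq F}
    (hS : S = toFqSub Fq Fqt hle Sbar ⊔ smulSub Fq b (powSpan Fq lam m)) {α : F} (hα : α ∉ Fqt) :
    finrank Fq ↥(S ⊓ smulSub Fq α S) = 2 * m := by
  have hα0 : α ≠ 0 := fun h => hα (h ▸ Fqt.zero_mem)
  have hinf := inf_smulSub_eq_bot hH hl hα
  have hl' : finrank Fqt (smulSub Fqt α Sbar) = 1 := by rw [finrank_smulSub Fqt hα0, hl]
  have hF := finrank_eq_add_one hb hbint hY (by omega)
  have : FiniteDimensional Fqt F := .of_finrank_pos (by omega)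
  have hsup : Sbar ⊔ smulSub Fqt α Sbar = ⊤ := by
    apply Submodule.eq_top_of_finrank_eq
    have := Submodule.finrank_sup_add_finrank_inf_eq Sbar (smulSub Fqt α Sbar)
    rw [hinf, finrank_bot] at this
    omega
  have hdisj : ∀ x, x ∈ Sbar → x ∈ smulSub Fqt α Sbar → x = 0 := fun x h1 h2 => by
    have : x ∈ (⊥ : Submodule Fqt F) := hinf ▸ ⟨h1, h2⟩
    simpa using this
  have hbS : b ∉ Sbar := fun h => one_ne_zero
    (eq_zero_of_mul_mem hb hbint Fqt.one_mem (by rwa [mul_one]))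
  have hbS' : α * b ∉ smulSub Fqt α Sbar := by
    intro h
    obtain ⟨y, hy, hyb⟩ := (mem_smulSub Fqt).1 h
    exact hbS (mul_left_cancel₀ hα0 hyb ▸ hy)
  obtain ⟨w, hw, u, hu, hwu⟩ := Submodule.mem_sup.1 (hsup ▸ Submodule.mem_top : b ∈ _)
  obtain ⟨v, hv, w', hw', hvw⟩ := Submodule.mem_sup.1 (hsup ▸ Submodule.mem_top : α * b ∈ _)
  have hu0 : u ≠ 0 := by rintro rfl; rw [add_zero] at hwu; exact hbS (hwu ▸ hw)
  have hv0 : v ≠ 0 := by rintro rfl; rw [zero_add] at hvw; exact hbS' (hvw ▸ hw')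
  have hP : ∀ x ∈ powSpan Fq lam m, x ∈ Fqt := fun x hx =>
    mem_subfieldModule.1 (powSpan_le_subfieldModule (hle := hle) hmem m hx)
  have hmemS : ∀ z, z ∈ S ↔ ∃ s ∈ Sbar, ∃ c ∈ powSpan Fq lam m, s + b * c = z := by
    intro z
    simp only [hS, Submodule.mem_sup, mem_smulSub, mem_toFqSub, exists_exists_and_eq_and]
  have hrange : S ⊓ smulSub Fq α S =
      smulSub Fq u (powSpan Fq lam m) ⊔ smulSub Fq v (powSpan Fq lam m) := by
    ext z
    simp only [Submodule.mem_inf, mem_smulSub, Submodule.mem_sup, exists_exists_and_eq_and,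
      hmemS]
    constructor
    · rintro ⟨⟨s, hs, x, hx, rfl⟩, _, ⟨s', hs', y, hy, rfl⟩, hz⟩
      refine ⟨x, hx, y, hy, ?_⟩
      rw [eq_comm, ← sub_eq_zero]
      apply hdisj
      · have : s + b * x - (u * x + v * y) = s + w * x - v * y := by rw [← hwu]; ring
        rw [this]
        exact Sbar.sub_mem (Sbar.add_mem hs (mul_mem_right hw (hP x hx)))
          (mul_mem_right hv (hP y hy))
      · have : s + b * x - (u * x + v * y) = α * s' + w' * y - u * x := by
          linear_combination -hz - y * hvw
        rw [this]
        exact Submodule.sub_mem _ (Submodule.add_mem _ ((mem_smulSub Fqt).2 ⟨s', hs', rfl⟩)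
          (mul_mem_right hw' (hP y hy))) (mul_mem_right hu (hP x hx))
    · rintro ⟨x, hx, y, hy, rfl⟩
      refine ⟨⟨v * y - w * x, Sbar.sub_mem (mul_mem_right hv (hP y hy))
        (mul_mem_right hw (hP x hx)), x, hx, by rw [← hwu]; ring⟩, ?_⟩
      have hmemα : u * x - w' * y ∈ smulSub Fqt α Sbar :=
        Submodule.sub_mem _ (mul_mem_right hu (hP x hx)) (mul_mem_right hw' (hP y hy))
      obtain ⟨s, hs, hsα⟩ := (mem_smulSub Fqt).1 hmemα
      exact ⟨s + b * y, ⟨s, hs, y, hy, rfl⟩, by linear_combination hsα - y * hvw⟩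
  have hbot : smulSub Fq u (powSpan Fq lam m) ⊓ smulSub Fq v (powSpan Fq lam m) = ⊥ := by
    rw [eq_bot_iff]
    rintro z ⟨hz, hz'⟩
    obtain ⟨x, hx, rfl⟩ := (mem_smulSub Fq).1 hz
    obtain ⟨y, hy, hyx⟩ := (mem_smulSub Fq).1 hz'
    rw [hdisj _ (hyx ▸ mul_mem_right hv (hP y hy)) (mul_mem_right hu (hP x hx))]
    exact Submodule.zero_mem _
  have h := Submodule.finrank_sup_add_finrank_inf_eq (smulSub Fq u (powSpan Fq lam m))
    (smulSub Fq v (powSpan Fq lam m))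
  rw [hbot, finrank_bot, finrank_smulSub Fq hu0, finrank_smulSub Fq hv0, finrank_powSpan hm] at h
  rw [hrange]
  omega

end InfiniteField

section Weights

open Polynomial

variable {F : Type*} [Field F] {Fq Fqt : Subfield F} {hle : Fq ≤ Fqt} {Sbar : Submodule Fqt F}
  {b : F}

theorem wt_eq_zero_of_finrank_ne [Infinite Fq] (hb : b ≠ 0)
    (hbint : {x : F | ∃ c ∈ Fqt, x = b * c} ∩ (Sbar : Set F) = {0})
    (hY : toFqSub Fq Fqt hle Sbar ⊔ smulSub Fq b (subfieldModule Fq Fqt hle) = ⊤)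
    (hH : HStabSet (Sbar : Set F) = (Fqt : Set F)) {l : ℕ} (hSbar : finrank Fqt Sbar = l)
    (hl : 0 < l) {lam : F} (hmem : lam ∈ Fqt)
    {t : ℕ} (ht : t = (minpoly Fq lam).natDegree)
    (hT : finrank Fq (subfieldModule Fq Fqt hle) ≠ t) {m : ℕ} (hm0 : 0 < m) (hm : m < t)
    {S : Submodule Fq F}
    (hS : S = toFqSub Fq Fqt hle Sbar ⊔ smulSub Fq b (powSpan Fq lam m)) {d : ℕ}
    (hd : t * (l - 1) + 2 * m ≤ d) (hd' : d < t * l + m) : wt Fq S d = 0 := by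
  have hSbot : Sbar ≠ ⊥ := by
    rintro rfl
    rw [finrank_bot] at hSbar
    omega
  have hF := finrank_eq_add_one hb hbint hY (by omega)
  have hdvd := natDegree_dvd_finrank_subfieldModule hle hmem (by omega)
  rw [← ht] at hdvd
  have hT2 : 0 < finrank Fq (subfieldModule Fq Fqt hle) →
      2 * t ≤ finrank Fq (subfieldModule Fq Fqt hle) := by
    intro h
    obtain ⟨e, he⟩ := hdvd
    rw [he] at h hT ⊢
    match e with
    | 0 => omega
    | 1 => omega
    | e + 2 => nlinarith
  rcases Nat.lt_or_ge 1 l with hl1 | hl1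
  · refine wt_eq_zero_of_forall_ne fun α hα heq => ?_
    obtain ⟨r, rfl⟩ : ∃ r, l = r + 2 := ⟨l - 2, by omega⟩
    have : FiniteDimensional Fqt F := .of_finrank_pos (by omega)
    have hW : Sbar ⊓ smulSub Fqt α Sbar ≠ ⊥ := by
      intro hbot
      have h := Submodule.finrank_sup_add_finrank_inf_eq Sbar (smulSub Fqt α Sbar)
      have h' := Submodule.finrank_le (Sbar ⊔ smulSub Fqt α Sbar)
      rw [hbot, finrank_bot, finrank_smulSub Fqt hα] at h
      omega
    have hpos := (finrank_subfieldModule_le hW (by omega) (toFqSub_inf_le (α := α) hS)).1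
    have hFq := finrank_eq_mul (F := F) hle
    rw [hF, hSbar] at hFq
    have : FiniteDimensional Fq F := .of_finrank_pos (by rw [hFq]; positivity)
    have hdS := finrank_sup_smulSub_powSpan (hle := hle) hb hbint hmem (m := m) (by omega)
    rw [← hS, hSbar] at hdS
    have h := Submodule.finrank_sup_add_finrank_inf_eq S (smulSub Fq α S)
    have h' := Submodule.finrank_le (S ⊔ smulSub Fq α S)
    rw [finrank_smulSub Fq hα, hdS, heq] at h
    rw [hFq] at h'
    have := hT2 hpos
    nlinarith [Nat.zero_le (r * t), Nat.mul_le_mul_right r this]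
  · obtain rfl : l = 1 := by omega
    have hlarge : ∀ U : Submodule Fq F, 0 < finrank Fq U → toFqSub Fq Fqt hle Sbar ≤ U →
        2 * t ≤ finrank Fq U := fun U hU hSU => by
      obtain ⟨h1, h2⟩ := finrank_subfieldModule_le hSbot hU hSU
      exact (hT2 h1).trans h2
    have hout : ∀ α : F, α ∉ Fqt → finrank Fq ↥(S ⊓ smulSub Fq α S) = 2 * m := fun α hα =>
      finrank_inf_smulSub_of_notMem hb hbint hY hH hSbar hmem (by omega) hS hα
    by_cases hdm : d = 2 * m
    · obtain ⟨θ, hθ⟩ := exists_notMem_of_finrank_ne_one (F := F) (Fqt := Fqt) (by omega)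
      refine wt_eq_zero_of_notMem hle hθ (hdm ▸ hout) fun h => ?_
      have := hlarge S (by omega) (hS ▸ le_sup_left)
      omega
    · refine wt_eq_zero_of_forall_ne fun α hα heq => ?_
      by_cases hαt : α ∈ Fqt
      · have hstab : smulSub Fqt α Sbar = Sbar :=
          smulSub_coe (⟨α, hαt⟩ : Fqt) (fun h => hα (congrArg Subtype.val h)) Sbar
        have hsub := toFqSub_inf_le (α := α) hS
        rw [hstab, inf_idem] at hsub
        have := hlarge _ (by omega) hsub
        omega
      · exact hdm (heq ▸ hout α hαt)

theorem add_coe_ne_zero {lam : F} (hlam : lam ∉ Fq) (c : Fq) : lam + c ≠ 0 := fun h =>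
  hlam (eq_neg_of_add_eq_zero_left h ▸ Fq.neg_mem c.2)

theorem aeval_X_add_C_pow (lam : F) (c : Fq) (i : ℕ) :
    aeval lam ((X + C c) ^ i) = (lam + c) ^ i := by
  simp [Subfield.algebraMap_ofSubfield]

theorem finrank_powSpan_inf_pow {lam : F} (hlam : lam ∉ Fq) (c : Fq) {i j : ℕ}
    (hij : j + i ≤ (minpoly Fq lam).natDegree) (hi : i < (minpoly Fq lam).natDegree) :
    finrank Fq ↥(powSpan Fq lam j ⊓ smulSub Fq ((lam + c) ^ i) (powSpan Fq lam j)) = j - i := by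
  refine finrank_powSpan_inf_of_coprime (pow_ne_zero _ (add_coe_ne_zero hlam c))
    (f := (X + C c) ^ i) (g := 1) isCoprime_one_right (by simp) (by simp) (by simp) hij hi ?_
  rw [aeval_X_add_C_pow, map_one, mul_one]

theorem finrank_powSpan_inf_div_pow {lam : F} (hlam : lam ∉ Fq) {c c' : Fq} (hc : c ≠ c') {i j : ℕ}
    (hij : j + i ≤ (minpoly Fq lam).natDegree) (hi : i < (minpoly Fq lam).natDegree) :
    finrank Fq ↥(powSpan Fq lam j ⊓
      smulSub Fq ((lam + c) ^ i / (lam + c') ^ i) (powSpan Fq lam j)) = j - i := by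
  have hne : ∀ c : Fq, (lam + c) ^ i ≠ 0 := fun c => pow_ne_zero _ (add_coe_ne_zero hlam c)
  have hcop : IsCoprime ((X + C c) ^ i) ((X + C c') ^ i) := by
    apply IsCoprime.pow
    have := isCoprime_X_sub_C_of_isUnit_sub (a := -c) (b := -c')
      (isUnit_iff_ne_zero.2 (by rwa [neg_sub_neg, sub_ne_zero, ne_comm]))
    simpa using this
  refine finrank_powSpan_inf_of_coprime (div_ne_zero (hne c) (hne c')) hcop
    (by simp) (by simp) (by simp) hij hi ?_
  rw [aeval_X_add_C_pow, aeval_X_add_C_pow, div_mul_cancel₀ _ (hne c')]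

theorem wt_eq_zero_of_finrank_eq [Infinite Fq] [FiniteDimensional Fq F] (hb : b ≠ 0)
    (hbint : {x : F | ∃ c ∈ Fqt, x = b * c} ∩ (Sbar : Set F) = {0})
    (hY : toFqSub Fq Fqt hle Sbar ⊔ smulSub Fq b (subfieldModule Fq Fqt hle) = ⊤)
    (hl : 0 < finrank Fqt Sbar) {lam : F} (hlam : lam ∉ Fq) (hmem : lam ∈ Fqt)
    {t : ℕ} (ht : t = (minpoly Fq lam).natDegree)
    (hT : finrank Fq (subfieldModule Fq Fqt hle) = t) {m : ℕ} (hm : m < t) {S : Submodule Fq F}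
    (hS : S = toFqSub Fq Fqt hle Sbar ⊔ smulSub Fq b (powSpan Fq lam m)) {i : ℕ} (hi : 0 < i)
    (him : i ≤ t - m) (hmt : t < 2 * m) :
    wt Fq S (t * (finrank Fqt Sbar - 1) + 2 * m + (t - m - i)) = 0 := by
  have key := fun α (hα : α ≠ 0) => finrank_inf_smulSub hb hbint hY hl hmem ht hT hm hS hα
  have hdS := finrank_sup_smulSub_powSpan (hle := hle) hb hbint hmem (m := m) (by omega)
  rw [← hS, hT] at hdS
  obtain ⟨r, hr⟩ : ∃ r, finrank Fqt Sbar = r + 1 := ⟨_, (Nat.sub_add_cancel hl).symm⟩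
  rw [hr, mul_add, mul_one] at hdS
  simp only [hr, Nat.add_sub_cancel] at key ⊢
  rcases him.lt_or_eq with hlt | rfl
  · have hne : ∀ c : Fq, (lam + c) ^ i ≠ 0 := fun c => pow_ne_zero _ (add_coe_ne_zero hlam c)
    refine wt_eq_zero_of_family (fun c => (lam + c) ^ i) hne (fun c => ?_) fun c c' hcc => ?_
    · rw [key _ (hne c), finrank_powSpan_inf_pow hlam c (by omega) (by omega)]
    · rw [key _ (div_ne_zero (hne c) (hne c')),
        finrank_powSpan_inf_div_pow hlam hcc (by omega) (by omega), hdS]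
      omega
  · rw [Nat.sub_self, add_zero]
    obtain ⟨θ, hθ⟩ := exists_notMem_of_finrank_ne_one (F := F) (Fqt := Fqt)
      (by have := finrank_eq_add_one hb hbint hY hl; omega)
    refine wt_eq_zero_of_notMem hle hθ (fun γ hγ => ?_) (by omega)
    rw [key γ fun h => hγ (h ▸ Fqt.zero_mem), finrank_powSpan_inf_of_notMem hle hmem hγ, add_zero]

/-- Over a finite field the stabilizer of `⟨1, …, lam^(N-1)⟩` is the base field. -/
theorem mem_of_finrank_powSpan_inf [Finite F] {lam : F} {N : ℕ} (hN : 0 < N)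
    (hNt : 2 * N ≤ (minpoly Fq lam).natDegree) {α : F} (hα : α ≠ 0)
    (h : finrank Fq ↥(powSpan Fq lam N ⊓ smulSub Fq α (powSpan Fq lam N)) = N) : α ∈ Fq := by
  classical
  have := Fintype.ofFinite F
  have hcard := card_filter_finrank_powSpan (Fq := Fq) rfl Finite.one_lt_card hNt hN
  have hsub : ((Finset.univ.filter fun c : Fq => c ≠ 0).image Subtype.val) ⊆
      (Finset.univ.filter fun α : F => α ≠ 0 ∧
        finrank Fq ↥(powSpan Fq lam N ⊓ smulSub Fq α (powSpan Fq lam N)) = N - 0) := by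
    intro x hx
    obtain ⟨c, hc, rfl⟩ := Finset.mem_image.1 hx
    have hc0 : c ≠ 0 := (Finset.mem_filter.1 hc).2
    refine Finset.mem_filter.2 ⟨Finset.mem_univ _, fun h => hc0 (Subtype.ext h), ?_⟩
    rw [smulSub_coe c hc0, inf_idem, finrank_powSpan (by omega), Nat.sub_zero]
  have heq := Finset.eq_of_subset_of_card_le hsub (by
    rw [hcard, Finset.card_image_of_injective _ Subtype.val_injective, Finset.filter_ne',
      Finset.card_erase_of_mem (Finset.mem_univ _), Finset.card_univ, Nat.card_eq_fintype_card]
    exact le_rfl)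
  have hmem : α ∈ Finset.univ.filter fun α : F => α ≠ 0 ∧
      finrank Fq ↥(powSpan Fq lam N ⊓ smulSub Fq α (powSpan Fq lam N)) = N - 0 :=
    Finset.mem_filter.2 ⟨Finset.mem_univ _, hα, h⟩
  rw [← heq] at hmem
  obtain ⟨c, -, rfl⟩ := Finset.mem_image.1 hmem
  exact c.2

theorem card_filter_finrank_powSpan_eq_zero [Fintype F] [DecidableEq F] {q : ℕ}
    (hq : Nat.card Fq = q) (hq2 : 2 ≤ q) {lam : F} {N : ℕ}
    (hNt : 2 * (N + 1) ≤ (minpoly Fq lam).natDegree) :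
    ((Finset.univ.filter fun α : F => α ≠ 0 ∧
      finrank Fq ↥(powSpan Fq lam (N + 1) ⊓ smulSub Fq α (powSpan Fq lam (N + 1))) = 0).card : ℤ) =
      Fintype.card F - (q : ℤ) ^ (2 * N + 1) := by
  set dim : F → ℕ := fun α =>
    finrank Fq ↥(powSpan Fq lam (N + 1) ⊓ smulSub Fq α (powSpan Fq lam (N + 1)))
  have hle : ∀ α, dim α ≤ N + 1 := fun α =>
    (Submodule.finrank_mono inf_le_left).trans_eq (finrank_powSpan (by omega))
  have htotal : (Finset.univ.filter fun α : F => α ≠ 0).card = Fintype.card F - 1 := by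
    rw [Finset.filter_ne', Finset.card_erase_of_mem (Finset.mem_univ _), Finset.card_univ]
  have hpos : 1 ≤ Fintype.card F := Fintype.card_pos
  rw [Finset.card_eq_sum_card_fiberwise (f := fun α => N + 1 - dim α) (t := Finset.range (N + 2))
    (fun α _ => by simp; omega), Finset.sum_range_succ] at htotal
  have hfib : ∀ i ≤ N + 1, ((Finset.univ.filter fun α : F => α ≠ 0).filter fun α =>
      N + 1 - dim α = i) = Finset.univ.filter fun α : F => α ≠ 0 ∧ dim α = N + 1 - i := by
    intro i hi
    rw [Finset.filter_filter]
    refine Finset.filter_congr fun α _ => and_congr_right fun _ => ?_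
    have := hle α
    omega
  have hlow : ∀ i ∈ Finset.range (N + 1), ((Finset.univ.filter fun α : F => α ≠ 0).filter fun α =>
      N + 1 - dim α = i).card = ratCount q i := fun i hi => by
    have hi' := Finset.mem_range.1 hi
    rw [hfib i (by omega)]
    exact card_filter_finrank_powSpan hq hq2 hNt hi'
  rw [Finset.sum_congr rfl hlow, hfib _ le_rfl, Nat.sub_self] at htotal
  have htotal' := congrArg (Nat.cast : ℕ → ℤ) htotal
  rw [Nat.cast_add, Nat.cast_sum, sum_ratCount (by omega), Nat.cast_sub hpos,
    Nat.cast_one] at htotal'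
  change ((Finset.univ.filter fun α : F => α ≠ 0 ∧ dim α = 0).card : ℤ) = _
  linarith

end Weights

/-- suppose `Y = F`, `H(S̄) = F_{q^t}` and `2m > t` (the case `r = 2m + t(l-1)`).
Then `ω_{2i} = (q+1)q^{2i-1}` for `i ∈ {1, …, t-m-1}` and
`ω_{2(t-m)} = (q^n - q^{2(t-m)-1})/(q-1)`. -/
theorem stmt15 (q n : ℕ) (hn : 0 < n)
    (F : Type*) [Field F] (hF : Nat.card F = q ^ n)
    (Fq Fqt : Subfield F) (hq : Nat.card Fq = q) (hle : Fq ≤ Fqt)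
    (lam : F) (hlam : lam ∉ Fq) (hmem : lam ∈ Fqt)
    (t : ℕ) (ht : t = (minpoly Fq lam).natDegree) (hqt : Nat.card Fqt = q ^ t)
    (l : ℕ) (hl : 0 < l)
    (Sbar : Submodule Fqt F) (hSbar : finrank Fqt Sbar = l)
    (b : F) (hb : b ≠ 0)
    (hbint : {x : F | ∃ c ∈ Fqt, x = b * c} ∩ (Sbar : Set F) = {0})
    (m : ℕ) (hm1 : 0 < m) (hm2 : m < t)
    (Sm : Submodule Fq F) (hSm : Sm = Submodule.span Fq {x : F | ∃ j < m, x = lam ^ j})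
    (S : Submodule Fq F) (hS : S = toFqSub Fq Fqt hle Sbar ⊔ smulSub Fq b Sm)
    (Y : Submodule Fq F)
    (hY : Y = toFqSub Fq Fqt hle Sbar ⊔ smulSub Fq b (subfieldModule Fq Fqt hle))
    (hYtop : Y = ⊤) (hnt : n = t * (l + 1))
    (hHSbar : HStabSet (Sbar : Set F) = (Fqt : Set F))
    (hm : t < 2 * m) :
    (∀ i : ℕ, 1 ≤ i → i ≤ t - m - 1 →
        wt Fq S (t * l + m - i) = (q + 1) * q ^ (2 * i - 1)) ∧
      (wt Fq S (t * (l - 1) + 2 * m) : ℚ) =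
        ((q : ℚ) ^ n - (q : ℚ) ^ (2 * (t - m) - 1)) / ((q : ℚ) - 1) := by
  subst hSm hY
  change S = toFqSub Fq Fqt hle Sbar ⊔ smulSub Fq b (powSpan Fq lam m) at hS
  obtain ⟨r, rfl⟩ : ∃ r, l = r + 1 := ⟨l - 1, by omega⟩
  obtain ⟨N, hN⟩ : ∃ N, t - m = N + 1 := ⟨t - m - 1, by omega⟩
  have hl' : 0 < finrank Fqt Sbar := by omega
  have hdim : ∀ i, i ≤ t - m → t * (r + 1) + m - i = t * r + 2 * m + (t - m - i) := by
    intro i hi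
    rw [mul_add, mul_one]
    omega
  rcases Nat.eq_zero_or_pos q with rfl | hq0
  · have : Infinite Fq := (Nat.card_eq_zero.1 hq).resolve_left (not_isEmpty_of_nonempty _)
    have hzero : ∀ i, 0 < i → i ≤ t - m → wt Fq S (t * r + 2 * m + (t - m - i)) = 0 := by
      intro i hi him
      by_cases hT : finrank Fq (subfieldModule Fq Fqt hle) = t
      · have hFq := finrank_eq_mul (F := F) hle
        rw [hT, finrank_eq_add_one hb hbint hYtop hl'] at hFq
        have : FiniteDimensional Fq F :=
          .of_finrank_pos (hFq ▸ Nat.mul_pos (by omega) (by omega))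
        have h := wt_eq_zero_of_finrank_eq hb hbint hYtop hl' hlam hmem ht hT hm2 hS hi him hm
        rwa [hSbar, Nat.add_sub_cancel] at h
      · refine wt_eq_zero_of_finrank_ne hb hbint hYtop hHSbar hSbar hl hmem ht hT hm1 hm2 hS
          ?_ ?_
        · rw [Nat.add_sub_cancel]; omega
        · rw [mul_add, mul_one]; omega
    constructor
    · intro i hi him
      rw [hdim i (by omega), hzero i hi (by omega), zero_pow (by omega), mul_zero]
    · have h := hzero (t - m) (by omega) le_rfl
      rw [Nat.sub_self, add_zero] at h
      rw [Nat.add_sub_cancel, h, Nat.cast_zero, zero_pow (by omega), zero_pow (by omega)]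
      simp
  · have : Finite F := Nat.finite_of_card_ne_zero (by rw [hF]; positivity)
    classical
    have := Fintype.ofFinite F
    have hq2 : 2 ≤ q := hq ▸ Finite.one_lt_card
    have hT : finrank Fq (subfieldModule Fq Fqt hle) = t := by
      have h := natCard_eq_pow_finrank (K := Fq) (V := subfieldModule Fq Fqt hle)
      have h' : Nat.card (subfieldModule Fq Fqt hle) = q ^ t := hqt
      rw [h', hq] at h
      exact (Nat.pow_right_injective hq2 h).symm
    have key := fun α (hα : α ≠ 0) =>
      finrank_inf_smulSub hb hbint hYtop hl' hmem ht hT hm2 hS hα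
    have hdS := finrank_sup_smulSub_powSpan (hle := hle) hb hbint hmem (m := m) (by omega)
    rw [← hS, hT, hSbar, mul_add, mul_one] at hdS
    simp only [hSbar, Nat.add_sub_cancel] at key ⊢
    have hstab : ∀ α : F, α ≠ 0 → smulSub Fq α S = S → α ∈ Fq := by
      intro α hα hαS
      have h := key α hα
      rw [hαS, inf_idem, hdS] at h
      exact mem_of_finrank_powSpan_inf (lam := lam) (N := t - m) (by omega) (by omega) hα (by omega)
    have hwt : ∀ e, wt Fq S (t * r + 2 * m + e) * (q - 1) =
        (Finset.univ.filter fun α : F => α ≠ 0 ∧ finrank Fq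
          ↥(powSpan Fq lam (t - m) ⊓ smulSub Fq α (powSpan Fq lam (t - m))) = e).card := by
      intro e
      rw [wt_mul_eq_card hq hstab]
      congr 1
      refine Finset.filter_congr fun α _ => and_congr_right fun hα => ?_
      rw [key α hα, Nat.add_right_inj]
    constructor
    · intro i hi him
      have h := hwt (t - m - i)
      rw [card_filter_finrank_powSpan hq hq2 (by omega) (by omega : i < t - m), ratCount,
        if_neg (by omega)] at h
      rw [hdim i (by omega)]
      apply Nat.eq_of_mul_eq_mul_right (by omega : 0 < q - 1)
      rw [h, mul_right_comm, ← Nat.sq_sub_sq, one_pow]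
    · have h := hwt 0
      rw [add_zero, hN] at h
      have h' := card_filter_finrank_powSpan_eq_zero hq hq2 (lam := lam) (N := N) (by omega)
      rw [← h, ← Nat.card_eq_fintype_card, hF] at h'
      have hq1 : (q : ℚ) - 1 ≠ 0 := by
        have : (2 : ℚ) ≤ q := by exact_mod_cast hq2
        linarith
      rw [eq_div_iff hq1, hN, show 2 * (N + 1) - 1 = 2 * N + 1 by omega]
      push_cast [Nat.cast_sub hq0] at h'
      exact_mod_cast h'
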